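/- arXiv:2106.03214 — 6 statements merged into one kernel-verified Lean document; each statement's English description precedes it below -/
import Mathlib

section
/- For every n ≥ 1 and every r ≥ 0, if the function F_H : 𝔽₂ⁿ → ℂ defined by F_H(x) = cos(π/8)^(n−|x|) · sin(π/8)^(|x|) can be written as F_H = Σ_{j=1}^r c_j φ_j with c_j ∈ ℂ and each φ_j a stabilizer function, then r > n/100. In particular the stabilizer rank of F_H is Ω(n). -/
open scoped BigOperators Classical

noncomputable section

/-- A subset of `𝔽₂ⁿ` is an affine subspace if it is a coset of an `𝔽₂`-linear subspace. -/
def IsAffineSubspace {n : ℕ} (A : Set (Fin n → ZMod 2)) : Prop :=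
  ∃ (u : Fin n → ZMod 2) (U₀ : Submodule (ZMod 2) (Fin n → ZMod 2)),
    A = {x | x - u ∈ U₀}

/-- A stabilizer function is `x ↦ i^{ℓ(x)} (-1)^{q(x)} 𝟙_A(x)` with `ℓ` linear, `q` quadratic
and `A` an affine subspace of `𝔽₂ⁿ`. -/
def IsStabilizer {n : ℕ} (φ : (Fin n → ZMod 2) → ℂ) : Prop :=
  ∃ (ℓ : (Fin n → ZMod 2) →ₗ[ZMod 2] ZMod 2)
    (q : MvPolynomial (Fin n) (ZMod 2)) (A : Set (Fin n → ZMod 2)),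
      q.totalDegree ≤ 2 ∧ IsAffineSubspace A ∧
      ∀ x, φ x = Complex.I ^ (ℓ x).val * (-1 : ℂ) ^ (MvPolynomial.eval x q).val *
        (if x ∈ A then 1 else 0)

/-- Any finite family of affine subspaces can be made constant (each either containing or missing
the whole piece) by imposing at most one linear condition per member of the family. -/
theorem exists_dual_finset_forall_mem_iff {n : ℕ} {ι : Type*} (A : ι → Set (Fin n → ZMod 2))
    (hA : ∀ j, IsAffineSubspace (A j)) (s : Finset ι) :
    ∃ (T : Finset (Module.Dual (ZMod 2) (Fin n → ZMod 2))) (y : Fin n → ZMod 2),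
      T.card ≤ s.card ∧
        ∀ j ∈ s, ∀ x, (∀ g ∈ T, g x = g y) → (x ∈ A j ↔ y ∈ A j) := by
  induction s using Finset.induction_on with
  | empty => exact ⟨∅, 0, by simp, by simp⟩
  | insert j s hj ih =>
    obtain ⟨T, y, hcard, hT⟩ := ih
    by_cases h : ∀ x, (∀ g ∈ T, g x = g y) → x ∈ A j
    · refine ⟨T, y, hcard.trans (Finset.card_le_card (Finset.subset_insert _ _)), ?_⟩
      intro k hk x hx
      rcases Finset.mem_insert.1 hk with rfl | hk
      · exact iff_of_true (h x hx) (h y fun _ _ => rfl)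
      · exact hT k hk x hx
    · push Not at h
      obtain ⟨z, hz, hzA⟩ := h
      obtain ⟨u, U, hU⟩ := hA j
      have hzU : z - u ∉ U := by simpa [hU] using hzA
      obtain ⟨g, hg, hgU⟩ := Submodule.exists_le_ker_of_notMem hzU
      refine ⟨insert g T, z, ?_, ?_⟩
      · rw [Finset.card_insert_of_notMem hj]
        exact (Finset.card_insert_le _ _).trans (by omega)
      intro k hk x hx
      have hxT : ∀ f ∈ T, f x = f y := fun f hf =>
        (hx f (Finset.mem_insert_of_mem hf)).trans (hz f hf)
      rcases Finset.mem_insert.1 hk with rfl | hk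
      · refine iff_of_false (fun hxA => ?_) hzA
        have hxU : x - u ∈ U := by simpa [hU] using hxA
        have h0 : g (x - u) = 0 := hgU hxU
        apply hg
        rw [map_sub, ← hx g (Finset.mem_insert_self _ _), ← map_sub, h0]
      · exact (hT k hk x hxT).trans (hT k hk z hz).symm

/-- A consistent system of linear conditions has a solution of weight at most the number of
conditions. -/
theorem exists_hammingNorm_le_card {n : ℕ}
    (T : Finset (Module.Dual (ZMod 2) (Fin n → ZMod 2))) (y : Fin n → ZMod 2) :
    ∃ a, (∀ g ∈ T, g a = g y) ∧ hammingNorm a ≤ T.card := by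
  obtain ⟨a, ha, hmin⟩ := Set.exists_min_image {x | ∀ g ∈ T, g x = g y} hammingNorm
    (Set.toFinite _) ⟨y, fun _ _ => rfl⟩
  refine ⟨a, ha, ?_⟩
  by_contra! hlt
  let S := {i : Fin n // a i ≠ 0}
  let e : (S → ZMod 2) →ₗ[ZMod 2] (Fin n → ZMod 2) :=
    Function.ExtendByZero.linearMap (ZMod 2) Subtype.val
  let M : (S → ZMod 2) →ₗ[ZMod 2] (T → ZMod 2) := LinearMap.pi fun g => g.1 ∘ₗ e
  have hM : LinearMap.ker M ≠ ⊥ := by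
    apply LinearMap.ker_ne_bot_of_finrank_lt
    simpa [S, hammingNorm, Fintype.card_subtype] using hlt
  obtain ⟨w, hw, hw0⟩ := Submodule.exists_mem_ne_zero_of_ne_bot hM
  obtain ⟨i, hi⟩ := Function.ne_iff.1 hw0
  have heS : ∀ k : S, e w k.1 = w k := fun k =>
    Subtype.val_injective.extend_apply w 0 k
  have heN : ∀ k, a k = 0 → e w k = 0 := fun k hk =>
    Function.extend_apply' (f := Subtype.val) w 0 k (by rintro ⟨b : S, rfl⟩; exact b.2 hk)
  have hadd : ∀ p q : ZMod 2, p ≠ 0 → q ≠ 0 → p + q = 0 := by decide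
  have hmem : a + e w ∈ {x | ∀ g ∈ T, g x = g y} := by
    intro g hg
    have h0 : g (e w) = 0 := congrFun (LinearMap.mem_ker.1 hw) ⟨g, hg⟩
    rw [map_add, h0, add_zero, ha g hg]
  refine absurd (hmin _ hmem) (not_le.2 (Finset.card_lt_card ?_))
  rw [Finset.ssubset_iff_of_subset]
  · refine ⟨i.1, by simpa using i.2, ?_⟩
    have : a i.1 + e w i.1 = 0 := hadd _ _ i.2 (by rw [heS]; exact hi)
    simpa using this
  · intro k hk
    simp only [Finset.mem_filter, Finset.mem_univ, true_and, Pi.add_apply] at hk ⊢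
    intro h
    exact hk (by rw [h, heN k h, add_zero])

/-- By Chevalley–Warning, a solution of few linear and quadratic conditions over `𝔽₂` is never
unique. -/
theorem exists_ne_forall_eq_of_card_lt {n r : ℕ}
    (L : Finset (Module.Dual (ZMod 2) (Fin n → ZMod 2)))
    (q : Fin r → MvPolynomial (Fin n) (ZMod 2)) (hq : ∀ j, (q j).totalDegree ≤ 2)
    (hlt : L.card + 2 * r < n) (a : Fin n → ZMod 2) :
    ∃ b, b ≠ a ∧ (∀ g ∈ L, g b = g a) ∧
      ∀ j, MvPolynomial.eval b (q j) = MvPolynomial.eval a (q j) := by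
  let lin (g : Module.Dual (ZMod 2) (Fin n → ZMod 2)) : MvPolynomial (Fin n) (ZMod 2) :=
    ∑ i, MvPolynomial.C (g (Pi.single i 1)) * MvPolynomial.X i
  have hlin : ∀ g x, MvPolynomial.eval x (lin g) = g x := by
    intro g x
    simp only [lin, map_sum, map_mul, MvPolynomial.eval_C, MvPolynomial.eval_X]
    conv_rhs => rw [LinearMap.pi_apply_eq_sum_univ g x]
    refine Finset.sum_congr rfl fun i _ => ?_
    rw [smul_eq_mul, mul_comm]
    congr 2
    ext k
    simp [Pi.single_apply, eq_comm]
  have hlindeg : ∀ g, (lin g).totalDegree ≤ 1 := by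
    intro g
    refine MvPolynomial.totalDegree_finsetSum_le fun i _ => ?_
    refine (MvPolynomial.totalDegree_mul _ _).trans ?_
    simp
  let f : L ⊕ Fin r → MvPolynomial (Fin n) (ZMod 2) :=
    Sum.elim (fun g => lin g.1 - MvPolynomial.C (g.1 a))
      (fun j => q j - MvPolynomial.C (MvPolynomial.eval a (q j)))
  have hdeg : ∑ i, (f i).totalDegree < Fintype.card (Fin n) := by
    rw [Fintype.sum_sum_type, Fintype.card_fin]
    refine lt_of_le_of_lt (add_le_add
      (Finset.sum_le_card_nsmul _ _ 1 fun g _ => ?_)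
      (Finset.sum_le_card_nsmul _ _ 2 fun j _ => ?_)) ?_
    · exact (MvPolynomial.totalDegree_sub_C_le _ _).trans (hlindeg _)
    · exact (MvPolynomial.totalDegree_sub_C_le _ _).trans (hq j)
    · simpa [mul_comm] using hlt
  have hdvd := char_dvd_card_solutions_of_fintype_sum_lt 2 hdeg
  have hone : 1 < Fintype.card {x : Fin n → ZMod 2 // ∀ i, MvPolynomial.eval x (f i) = 0} := by
    have hpos : 0 < Fintype.card {x : Fin n → ZMod 2 // ∀ i, MvPolynomial.eval x (f i) = 0} :=
      Fintype.card_pos_iff.2 ⟨a, by rintro (g | j) <;> simp [f, hlin]⟩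
    exact lt_of_lt_of_le one_lt_two (Nat.le_of_dvd hpos hdvd)
  obtain ⟨b, hb⟩ := Fintype.exists_ne_of_one_lt_card hone
    ⟨a, by rintro (g | j) <;> simp [f, hlin]⟩
  refine ⟨b.1, fun h => hb (Subtype.ext h), fun g hg => ?_, fun j => ?_⟩
  · simpa [f, hlin, sub_eq_zero] using b.2 (Sum.inl ⟨g, hg⟩)
  · simpa [f, sub_eq_zero] using b.2 (Sum.inr j)

theorem pow_sub_mul_pow_lt_of_lt {c s : ℝ} (hs : 0 < s) (hsc : s < c) {n k l : ℕ}
    (hkl : k < l) (hl : l ≤ n) : c ^ (n - l) * s ^ l < c ^ (n - k) * s ^ k := by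
  have h1 : s ^ l = s ^ (l - k) * s ^ k := by rw [← pow_add]; congr 1; omega
  have h2 : c ^ (n - k) = c ^ (n - l) * c ^ (l - k) := by rw [← pow_add]; congr 1; omega
  rw [h1, h2, ← mul_assoc]
  have hc : 0 < c := hs.trans hsc
  gcongr
  omega

theorem hammingNorm_lt_of_ne {n : ℕ} {a b : Fin n → ZMod 2} (hab : b ≠ a)
    (h : ∀ i, a i ≠ 0 → b i = a i) : hammingNorm a < hammingNorm b := by
  obtain ⟨i, hi⟩ := Function.ne_iff.1 hab
  have hai : a i = 0 := by_contra fun hne => hi (h i hne)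
  refine Finset.card_lt_card ((Finset.ssubset_iff_of_subset fun k hk => ?_).2 ⟨i, ?_, ?_⟩)
  · simp only [Finset.mem_filter, Finset.mem_univ, true_and] at hk ⊢
    rwa [h k hk]
  · simpa [hai] using hi
  · simpa using hai

theorem stabilizer_rank_H_linear_lower_bound (n r : ℕ) (hn : 1 ≤ n)
    (c : Fin r → ℂ) (φ : Fin r → (Fin n → ZMod 2) → ℂ)
    (hφ : ∀ j, IsStabilizer (φ j))
    (hdec : ∀ x : Fin n → ZMod 2,
      (Real.cos (Real.pi / 8) : ℂ) ^ (n - hammingNorm x) *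
        (Real.sin (Real.pi / 8) : ℂ) ^ (hammingNorm x) = ∑ j, c j * φ j x) :
    (n : ℝ) / 100 < (r : ℝ) := by
  by_contra! hr
  have hr' : r * 100 ≤ n := by
    have : (r : ℝ) * 100 ≤ n := by linarith
    exact_mod_cast this
  choose ℓ q A hq hA hφ using hφ
  obtain ⟨T, y, hT, hTA⟩ := exists_dual_finset_forall_mem_iff A hA Finset.univ
  obtain ⟨a, ha, haT⟩ := exists_hammingNorm_le_card T y
  rw [Finset.card_univ, Fintype.card_fin] at hT
  let P : Finset (Module.Dual (ZMod 2) (Fin n → ZMod 2)) :=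
    (Finset.univ.filter fun i => a i ≠ 0).image fun i => LinearMap.proj i
  have hP : P.card ≤ hammingNorm a := Finset.card_image_le
  have hℓ : (Finset.univ.image ℓ).card ≤ r := Finset.card_image_le.trans (by simp)
  have hL : (T ∪ Finset.univ.image ℓ ∪ P).card + 2 * r < n := by
    have h1 := Finset.card_union_le (T ∪ Finset.univ.image ℓ) P
    have h2 := Finset.card_union_le T (Finset.univ.image ℓ)
    omega
  obtain ⟨b, hba, hbL, hbq⟩ := exists_ne_forall_eq_of_card_lt _ q hq hL a
  have hlt : hammingNorm a < hammingNorm b := by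
    refine hammingNorm_lt_of_ne hba fun i hi => hbL (LinearMap.proj i) ?_
    exact Finset.mem_union_right _ (Finset.mem_image_of_mem _ (by simpa using hi))
  have hφab : ∀ j, φ j b = φ j a := by
    intro j
    have h1 : ℓ j b = ℓ j a := hbL _ (Finset.mem_union_left _
      (Finset.mem_union_right _ (Finset.mem_image_of_mem _ (Finset.mem_univ j))))
    have h2 : b ∈ A j ↔ a ∈ A j :=
      (hTA j (Finset.mem_univ j) b fun g hg => (hbL g (Finset.mem_union_left _
        (Finset.mem_union_left _ hg))).trans (ha g hg)).trans
        (hTA j (Finset.mem_univ j) a ha).symm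
    rw [hφ, hφ, h1, hbq]
    simp only [h2]
  have heq := (hdec b).trans ((Finset.sum_congr rfl fun j _ => by rw [hφab j]).trans
    (hdec a).symm)
  norm_cast at heq
  have hpi := Real.pi_pos
  have hsin : 0 < Real.sin (Real.pi / 8) :=
    Real.sin_pos_of_pos_of_lt_pi (by linarith) (by linarith)
  have hsc : Real.sin (Real.pi / 8) < Real.cos (Real.pi / 8) := by
    rw [← Real.sin_pi_div_two_sub]
    exact Real.sin_lt_sin_of_lt_of_le_pi_div_two (by linarith) (by linarith) (by linarith)
  have hbn : hammingNorm b ≤ n := by simpa using hammingNorm_le_card_fintype (x := b)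
  exact (pow_sub_mul_pow_lt_of_lt hsin hsc hlt hbn).ne heq
end
end

section
/- For every n ≥ 1 and every r ≥ 0, if the function F_R : 𝔽₂ⁿ → ℂ defined by F_R(x) = cos(β)^(n−|x|) · (e^{iπ/4} · sin(β))^(|x|), where β = (1/2)·arccos(1/√3), can be written as F_R = Σ_{j=1}^r c_j φ_j with c_j ∈ ℂ and each φ_j a stabilizer function, then r > n/100. In particular the stabilizer rank of F_R is Ω(n). -/
open scoped BigOperators Classical

noncomputable section

open MvPolynomial in
/-- By Chevalley–Warning, a common zero of polynomials over `𝔽₂` of small total degree is never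
the only one, even when the coordinates in `T` are kept fixed. -/
theorem exists_ne_common_zero_eqOn {n : ℕ} {ι : Type*} [Fintype ι]
    (P : ι → MvPolynomial (Fin n) (ZMod 2)) (T : Finset (Fin n))
    (hdeg : ∑ i, (P i).totalDegree + T.card < n)
    (x : Fin n → ZMod 2) (hx : ∀ i, eval x (P i) = 0) :
    ∃ y, y ≠ x ∧ (∀ i, eval y (P i) = 0) ∧ ∀ i ∈ T, y i = x i := by
  let Q : ι ⊕ T → MvPolynomial (Fin n) (ZMod 2) :=
    Sum.elim P fun i => X (i : Fin n) - C (x i)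
  have hQ : ∑ i, (Q i).totalDegree < Fintype.card (Fin n) := by
    rw [Fintype.sum_sum_type, Fintype.card_fin]
    refine lt_of_le_of_lt (Nat.add_le_add_left ?_ _) hdeg
    calc ∑ i : T, (Q (Sum.inr i)).totalDegree ≤ ∑ _i : T, 1 :=
          Finset.sum_le_sum fun i _ => (totalDegree_sub_C_le _ _).trans (totalDegree_X _).le
      _ = T.card := by simp
  have hdvd := char_dvd_card_solutions_of_fintype_sum_lt 2 hQ
  have hxQ : ∀ i, eval x (Q i) = 0 := by
    rintro (i | i)
    · exact hx i
    · simp [Q]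
  have hcard : 1 < Fintype.card {y // ∀ i, eval y (Q i) = 0} := by
    have := Fintype.card_pos_iff.mpr ⟨(⟨x, hxQ⟩ : {y // ∀ i, eval y (Q i) = 0})⟩
    omega
  obtain ⟨⟨y, hy⟩, hne⟩ := Fintype.exists_ne_of_one_lt_card hcard ⟨x, hxQ⟩
  refine ⟨y, fun h => hne (Subtype.ext h), fun i => hy (Sum.inl i), fun i hi => ?_⟩
  have := hy (Sum.inr ⟨i, hi⟩)
  simpa [Q, sub_eq_zero] using this

/-- The degree-one polynomial `ℓ - a`. -/
def linearSubConst {n : ℕ} (ℓ : (Fin n → ZMod 2) →ₗ[ZMod 2] ZMod 2) (a : ZMod 2) :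
    MvPolynomial (Fin n) (ZMod 2) :=
  ∑ i, MvPolynomial.C (ℓ (Pi.single i 1)) * MvPolynomial.X i - MvPolynomial.C a

theorem eval_linearSubConst {n : ℕ} (ℓ : (Fin n → ZMod 2) →ₗ[ZMod 2] ZMod 2) (a : ZMod 2)
    (x : Fin n → ZMod 2) : MvPolynomial.eval x (linearSubConst ℓ a) = ℓ x - a := by
  have h : ℓ x = ∑ i, ℓ (Pi.single i 1) * x i := by
    conv_lhs => rw [pi_eq_sum_univ' x]
    simp only [map_sum, map_smul, smul_eq_mul]
    exact Finset.sum_congr rfl fun i _ => mul_comm _ _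
  simp [linearSubConst, h]

theorem totalDegree_linearSubConst_le {n : ℕ} (ℓ : (Fin n → ZMod 2) →ₗ[ZMod 2] ZMod 2)
    (a : ZMod 2) : (linearSubConst ℓ a).totalDegree ≤ 1 := by
  refine (MvPolynomial.totalDegree_sub_C_le _ _).trans
    (MvPolynomial.totalDegree_finsetSum_le fun i _ => ?_)
  refine (MvPolynomial.totalDegree_mul _ _).trans ?_
  simp [MvPolynomial.totalDegree_X]

/-- A point outside an affine subspace lies on a hyperplane disjoint from that subspace. -/
theorem IsAffineSubspace.exists_separating_polynomial {n : ℕ} {A : Set (Fin n → ZMod 2)}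
    (hA : IsAffineSubspace A) {v : Fin n → ZMod 2} (hv : v ∉ A) :
    ∃ P : MvPolynomial (Fin n) (ZMod 2), P.totalDegree ≤ 1 ∧ MvPolynomial.eval v P = 0 ∧
      ∀ x ∈ A, MvPolynomial.eval x P ≠ 0 := by
  obtain ⟨u, U, rfl⟩ := hA
  obtain ⟨f, hf, hU⟩ := Submodule.exists_le_ker_of_notMem (p := U) (v := v - u) hv
  refine ⟨linearSubConst f (f v), totalDegree_linearSubConst_le _ _, ?_, fun x hx => ?_⟩
  · simp [eval_linearSubConst]
  · have h0 : f (x - u) = 0 := hU hx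
    rw [eval_linearSubConst, ← map_sub, show x - v = (x - u) - (v - u) by abel, map_sub, h0,
      zero_sub, neg_ne_zero]
    exact hf

/-- Finitely many affine subspaces can each be made trivial (everything or nothing) on a common
nonempty affine subspace cut out by one equation for each of them. -/
theorem exists_equations_trivializing {n : ℕ} {ι : Type*} (A : ι → Set (Fin n → ZMod 2))
    (hA : ∀ j, IsAffineSubspace (A j)) (s : Finset ι) :
    ∃ P : ι → MvPolynomial (Fin n) (ZMod 2), (∀ j, (P j).totalDegree ≤ 1) ∧
      (∀ j ∉ s, P j = 0) ∧ (∃ x, ∀ j, MvPolynomial.eval x (P j) = 0) ∧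
      ∀ j ∈ s, (∀ x, (∀ i, MvPolynomial.eval x (P i) = 0) → x ∈ A j) ∨
        (∀ x, (∀ i, MvPolynomial.eval x (P i) = 0) → x ∉ A j) := by
  induction s using Finset.induction_on with
  | empty => exact ⟨fun _ => 0, by simp⟩
  | insert a s ha ih =>
    obtain ⟨P, hdeg, hzero, hne, htriv⟩ := ih
    by_cases hall : ∀ x, (∀ i, MvPolynomial.eval x (P i) = 0) → x ∈ A a
    · refine ⟨P, hdeg, fun j hj => hzero j fun h => hj (Finset.mem_insert_of_mem h), hne, ?_⟩
      intro j hj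
      rcases Finset.mem_insert.mp hj with rfl | hj
      · exact Or.inl hall
      · exact htriv j hj
    · push Not at hall
      obtain ⟨v, hv, hvA⟩ := hall
      obtain ⟨L, hLdeg, hLv, hLA⟩ := (hA a).exists_separating_polynomial hvA
      have hold : ∀ x, (∀ i, MvPolynomial.eval x (Function.update P a L i) = 0) →
          ∀ i, MvPolynomial.eval x (P i) = 0 := by
        intro x hx i
        by_cases hi : i = a
        · subst hi
          simp [hzero i ha]
        · simpa [hi] using hx i
      refine ⟨Function.update P a L, fun j => ?_, fun j hj => ?_, ⟨v, fun j => ?_⟩, fun j hj => ?_⟩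
      · by_cases h : j = a
        · subst h; simpa using hLdeg
        · simpa [h] using hdeg j
      · rw [Finset.mem_insert, not_or] at hj
        simpa [hj.1] using hzero j hj.2
      · by_cases h : j = a
        · subst h; simpa using hLv
        · simpa [h] using hv j
      · rcases Finset.mem_insert.mp hj with rfl | hj
        · exact Or.inr fun x hx hxA => hLA x hxA (by simpa using hx j)
        · exact (htriv j hj).imp (fun h x hx => h x (hold x hx)) fun h x hx => h x (hold x hx)

/-- A consistent system of polynomial equations over `𝔽₂` has a solution whose Hamming weight is
at most the sum of the degrees. -/
theorem exists_common_zero_support_card_le {n : ℕ} {ι : Type*} [Fintype ι]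
    (P : ι → MvPolynomial (Fin n) (ZMod 2))
    (hne : ∃ x, ∀ i, MvPolynomial.eval x (P i) = 0) :
    ∃ x, (∀ i, MvPolynomial.eval x (P i) = 0) ∧
      (Finset.univ.filter fun i => x i ≠ 0).card ≤ ∑ i, (P i).totalDegree := by
  obtain ⟨x, hx, hmin⟩ := Set.exists_min_image {x | ∀ i, MvPolynomial.eval x (P i) = 0}
    (fun x => (Finset.univ.filter fun i => x i ≠ 0).card) (Set.toFinite _) hne
  refine ⟨x, hx, not_lt.mp fun hlt => ?_⟩
  have hcard : (Finset.univ.filter fun i => x i ≠ 0).card +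
      (Finset.univ.filter fun i => ¬ x i ≠ 0).card = n := by
    rw [Finset.card_filter_add_card_filter_not, Finset.card_univ, Fintype.card_fin]
  obtain ⟨y, hyx, hy, hT⟩ := exists_ne_common_zero_eqOn P
    (Finset.univ.filter fun i => ¬ x i ≠ 0) (by omega) x hx
  refine absurd (hmin y hy) (not_le.mpr (Finset.card_lt_card ?_))
  have hsub : ∀ i, x i = 0 → y i = 0 := fun i hi => by
    rw [hT i (by simpa using hi), hi]
  refine Finset.ssubset_iff_subset_ne.mpr ⟨fun i => ?_, fun heq => hyx ?_⟩
  · simpa using mt (hsub i)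
  · funext i
    by_cases hi : x i = 0
    · rw [hi, hsub i hi]
    · have hyi : y i ≠ 0 := by
        have : i ∈ Finset.univ.filter fun i => y i ≠ 0 := by rw [heq]; simpa using hi
        simpa using this
      exact (Fin.eq_one_of_ne_zero _ hyi).trans (Fin.eq_one_of_ne_zero _ hi).symm

/-- Few stabilizer functions cannot separate all pairs of points of different Hamming weight. -/
theorem exists_hammingNorm_lt_forall_stabilizer_eq {n r : ℕ} (hr : 5 * r < n)
    (φ : Fin r → (Fin n → ZMod 2) → ℂ) (hφ : ∀ j, IsStabilizer (φ j)) :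
    ∃ x y, hammingNorm x < hammingNorm y ∧ ∀ j, φ j x = φ j y := by
  choose ℓ q A hq hA hφ using hφ
  obtain ⟨P, hPdeg, -, hne, htriv⟩ := exists_equations_trivializing A hA Finset.univ
  obtain ⟨x, hx, hxcard⟩ := exists_common_zero_support_card_le P hne
  have sum_le : ∀ (R : Fin r → MvPolynomial (Fin n) (ZMod 2)) (d : ℕ),
      (∀ j, (R j).totalDegree ≤ d) → ∑ j, (R j).totalDegree ≤ r * d := fun R d h => by
    simpa using Finset.sum_le_sum fun j (_ : j ∈ Finset.univ) => h j
  let Q : Fin r ⊕ Fin r ⊕ Fin r → MvPolynomial (Fin n) (ZMod 2) :=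
    Sum.elim P (Sum.elim (fun j => linearSubConst (ℓ j) (ℓ j x))
      fun j => q j - MvPolynomial.C (MvPolynomial.eval x (q j)))
  have hP := sum_le P 1 hPdeg
  have hQ : ∑ i, (Q i).totalDegree ≤ 4 * r := by
    have h1 := sum_le (fun j => linearSubConst (ℓ j) (ℓ j x)) 1
      fun j => totalDegree_linearSubConst_le _ _
    have h2 := sum_le (fun j => q j - MvPolynomial.C (MvPolynomial.eval x (q j))) 2
      fun j => (MvPolynomial.totalDegree_sub_C_le _ _).trans (hq j)
    simp only [Fintype.sum_sum_type, Q, Sum.elim_inl, Sum.elim_inr]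
    omega
  obtain ⟨y, hyx, hy, hT⟩ := exists_ne_common_zero_eqOn Q
    (Finset.univ.filter fun i => x i ≠ 0) (by omega) x (by
      rintro (j | j | j)
      · exact hx j
      · simp [Q, eval_linearSubConst]
      · simp [Q])
  have hyP : ∀ j, MvPolynomial.eval y (P j) = 0 := fun j => hy (Sum.inl j)
  refine ⟨x, y, ?_, fun j => ?_⟩
  · unfold hammingNorm
    refine Finset.card_lt_card (Finset.ssubset_iff_subset_ne.mpr ⟨fun i hi => ?_, fun heq => ?_⟩)
    · have hi : x i ≠ 0 := by simpa using hi
      simpa [hT i (by simpa using hi)] using hi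
    · refine hyx (funext fun i => ?_)
      by_cases hi : x i = 0
      · by_contra hyi
        rw [hi] at hyi
        have : i ∈ Finset.univ.filter fun i => x i ≠ 0 := by
          convert (Finset.ext_iff.mp heq i).mpr (by simpa using hyi)
        simp [hi] at this
      · exact hT i (by simpa using hi)
  · have hℓ : ℓ j y = ℓ j x := by
      have := hy (Sum.inr (Sum.inl j))
      simpa [Q, eval_linearSubConst, sub_eq_zero] using this
    have hqj : MvPolynomial.eval y (q j) = MvPolynomial.eval x (q j) := by
      have := hy (Sum.inr (Sum.inr j))
      simpa [Q, sub_eq_zero] using this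
    have hmem : x ∈ A j ↔ y ∈ A j := by
      rcases htriv j (Finset.mem_univ j) with h | h
      · exact iff_of_true (h x hx) (h y hyP)
      · exact iff_of_false (h x hx) (h y hyP)
    rw [hφ j x, hφ j y, hℓ, hqj]
    simp only [hmem]

theorem pow_sub_mul_pow_lt {a b : ℝ} (hb : 0 < b) (hab : b < a) {n k m : ℕ} (hkm : k < m)
    (hmn : m ≤ n) : a ^ (n - m) * b ^ m < a ^ (n - k) * b ^ k := by
  obtain ⟨d, rfl⟩ := Nat.exists_eq_add_of_lt hkm
  have ha : 0 < a := hb.trans hab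
  have h : n - k = (n - (k + d + 1)) + (d + 1) := by omega
  rw [h, pow_add a, add_assoc k, pow_add b, mul_assoc, mul_comm (b ^ k)]
  have := pow_lt_pow_left₀ hab hb.le (Nat.succ_ne_zero d)
  gcongr

theorem stabilizer_rank_R_linear_lower_bound (n r : ℕ) (hn : 1 ≤ n)
    (c : Fin r → ℂ) (φ : Fin r → (Fin n → ZMod 2) → ℂ)
    (hφ : ∀ j, IsStabilizer (φ j))
    (hdec : ∀ x : Fin n → ZMod 2,
      (Real.cos (Real.arccos (1 / Real.sqrt 3) / 2) : ℂ) ^ (n - hammingNorm x) *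
        (Complex.exp (Complex.I * Real.pi / 4) *
          (Real.sin (Real.arccos (1 / Real.sqrt 3) / 2) : ℂ)) ^ (hammingNorm x) =
        ∑ j, c j * φ j x) :
    (n : ℝ) / 100 < (r : ℝ) := by
  by_contra! hle
  have hr : 5 * r < n := by
    have h : (100 * r : ℝ) ≤ n := by linarith
    have h : 100 * r ≤ n := by exact_mod_cast h
    omega
  obtain ⟨x, y, hxy, hφxy⟩ := exists_hammingNorm_lt_forall_stabilizer_eq hr φ hφ
  set β := Real.arccos (1 / Real.sqrt 3) / 2 with hβ
  have hβpos : 0 < β := by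
    have h : 1 / Real.sqrt 3 < 1 := by
      rw [div_lt_one (by positivity)]
      exact Real.lt_sqrt_of_sq_lt (by norm_num)
    have := Real.arccos_pos.mpr h
    positivity
  have hβlt : β < Real.pi / 4 := by
    have := Real.arccos_lt_pi_div_two.mpr (by positivity : 0 < 1 / Real.sqrt 3)
    linarith
  have hsin : 0 < Real.sin β := Real.sin_pos_of_pos_of_lt_pi hβpos (by linarith [Real.pi_pos])
  have hlt : Real.sin β < Real.cos β := by
    rw [← Real.sin_pi_div_two_sub]
    exact Real.sin_lt_sin_of_lt_of_le_pi_div_two (by linarith [Real.pi_pos]) (by linarith)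
      (by linarith)
  have hnorm : ∀ z : Fin n → ZMod 2, ‖∑ j, c j * φ j z‖ =
      Real.cos β ^ (n - hammingNorm z) * Real.sin β ^ hammingNorm z := by
    intro z
    have hexp : ‖Complex.exp (Complex.I * Real.pi / 4)‖ = 1 := by
      rw [show Complex.I * Real.pi / 4 = ((Real.pi / 4 : ℝ) : ℂ) * Complex.I by push_cast; ring]
      exact Complex.norm_exp_ofReal_mul_I _
    rw [← hdec z, norm_mul, norm_pow, norm_pow, norm_mul, hexp, one_mul, Complex.norm_real,
      Complex.norm_real, Real.norm_of_nonneg hsin.le, Real.norm_of_nonneg (hsin.trans hlt).le]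
  have hmn : hammingNorm y ≤ n := by
    simpa using hammingNorm_le_card_fintype (x := y)
  have heq : ∑ j, c j * φ j x = ∑ j, c j * φ j y := by simp only [hφxy]
  have := hnorm x
  rw [heq, hnorm y] at this
  exact (pow_sub_mul_pow_lt hsin hlt hxy hmn).ne this
end
end

section
/- Let n and r satisfy 1 ≤ r ≤ n/100. Let U = u + U₀ ⊆ 𝔽₂ⁿ be an affine subspace (U₀ a linear subspace) with dim(U) ≥ n − 3r, and let q_1, …, q_r be n-variate polynomials over 𝔽₂ of total degree at most 2. Then there exists v ∈ U₀ with Hamming weight |v| ≥ 2n/3 such that the system of equations q_j(x) = q_j(x + v) for all j ∈ [r] has a solution x ∈ U. -/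
theorem hammingDist_cons {α : Type*} [DecidableEq α] {n : ℕ} (a b : α) (x y : Fin n → α) :
    hammingDist (Fin.cons a x : Fin (n + 1) → α) (Fin.cons b y) =
      (if a = b then 0 else 1) + hammingDist x y := by
  simp only [hammingDist, Finset.card_filter, Fin.sum_univ_succ, Fin.cons_zero, Fin.cons_succ,
    ne_eq, ite_not]

theorem sum_cons_zmod_two {n : ℕ} (f : (Fin (n + 1) → ZMod 2) → ℝ) :
    ∑ x, f x = ∑ x : Fin n → ZMod 2, (f (Fin.cons 0 x) + f (Fin.cons 1 x)) := by
  rw [← (Fin.consEquiv fun _ => ZMod 2).sum_comp, Fintype.sum_prod_type, Finset.sum_add_distrib]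
  exact Fin.sum_univ_two _

theorem two_point_mul_le {a b c d K : ℝ} (ha : 0 ≤ a) (hb : 0 ≤ b) (hc : 0 ≤ c) (hac : a * c ≤ K)
    (hbd : b * d ≤ K) (had : a * d * 2 ≤ K) (hbc : b * c * 2 ≤ K) :
    (a + b) * (c + d) ≤ K * (9 / 4) := by
  have hK : 0 ≤ K := (mul_nonneg ha hc).trans hac
  rcases hK.eq_or_lt with rfl | hK
  · nlinarith
  have h₁ := mul_nonneg (sub_nonneg.2 hac) (sub_nonneg.2 hbd)
  have h₂ := mul_le_mul had hbc (by positivity) hK.le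
  have h₃ : K * (a * c + b * d) ≤ K * (K * (5 / 4)) := by nlinarith
  have h₄ := le_of_mul_le_mul_left h₃ hK
  nlinarith

/-- A functional form of the isodiametric inequality on the discrete cube. -/
theorem sum_mul_sum_le_of_mul_two_pow_hammingDist_le {n : ℕ} {f g : (Fin n → ZMod 2) → ℝ} {K : ℝ}
    (hf : ∀ x, 0 ≤ f x) (hg : ∀ x, 0 ≤ g x)
    (h : ∀ x y, f x * g y * 2 ^ hammingDist x y ≤ K) :
    (∑ x, f x) * ∑ x, g x ≤ K * (9 / 4) ^ n := by
  induction n generalizing K with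
  | zero =>
    rw [Fintype.sum_subsingleton f 0, Fintype.sum_subsingleton g 0, pow_zero, mul_one]
    simpa only [hammingDist_self, pow_zero, mul_one] using h 0 0
  | succ n ih =>
    rw [sum_cons_zmod_two f, sum_cons_zmod_two g, pow_succ', ← mul_assoc]
    refine ih (fun x => add_nonneg (hf _) (hf _)) (fun x => add_nonneg (hg _) (hg _)) ?_
    intro x y
    have hp : (0 : ℝ) < 2 ^ hammingDist x y := by positivity
    have h00 := h (Fin.cons 0 x) (Fin.cons 0 y)
    have h01 := h (Fin.cons 0 x) (Fin.cons 1 y)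
    have h10 := h (Fin.cons 1 x) (Fin.cons 0 y)
    have h11 := h (Fin.cons 1 x) (Fin.cons 1 y)
    simp only [hammingDist_cons, if_true, zero_ne_one, one_ne_zero, if_false, pow_add, pow_zero,
      pow_one, one_mul] at h00 h01 h10 h11
    rw [mul_assoc, add_mul (g _)]
    apply two_point_mul_le (hf _) (hf _) (mul_nonneg (hg _) hp.le) <;>
      linarith

theorem card_sq_le_of_hammingDist_le {n m : ℕ} {A : Finset (Fin n → ZMod 2)}
    (hA : ∀ a ∈ A, ∀ b ∈ A, hammingDist a b ≤ m) :
    (A.card : ℝ) ^ 2 ≤ 2 ^ m * (9 / 4) ^ n := by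
  classical
  have := sum_mul_sum_le_of_mul_two_pow_hammingDist_le (n := n) (K := 2 ^ m)
    (f := fun x => if x ∈ A then 1 else 0) (g := fun x => if x ∈ A then 1 else 0)
    (fun x => by positivity) (fun x => by positivity) (fun x y => by
      by_cases hx : x ∈ A <;> by_cases hy : y ∈ A <;> simp only [hx, hy, if_true, if_false]
      · simpa using pow_le_pow_right₀ (one_le_two (α := ℝ)) (hA x hx y hy)
      all_goals simp)
  simpa [sq] using this

/-- A subset of the cube of size at least `2 ^ (n - 4 r)`, where `100 r ≤ n`, has two points
at distance at least `2 n / 3`. -/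
theorem exists_two_mul_le_three_mul_hammingDist {n r : ℕ} (hn : 0 < n) (hr : 100 * r ≤ n)
    {A : Finset (Fin n → ZMod 2)} (hA : 2 ^ (n - 4 * r) ≤ A.card) :
    ∃ a ∈ A, ∃ b ∈ A, 2 * n ≤ 3 * hammingDist a b := by
  by_contra! hlt
  have hsq : (A.card : ℝ) ^ 2 ≤ 2 ^ (2 * n / 3) * (9 / 4) ^ n :=
    card_sq_le_of_hammingDist_le fun a ha b hb => by have := hlt a ha b hb; omega
  have hcard : (2 : ℝ) ^ (n - 4 * r) ≤ A.card := by exact_mod_cast hA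
  have hlower : (2 ^ 23 : ℝ) ^ n ≤ ((A.card : ℝ) ^ 2) ^ 12 := calc
    (2 ^ 23 : ℝ) ^ n = 2 ^ (23 * n) := (pow_mul _ _ _).symm
    _ ≤ 2 ^ ((n - 4 * r) * 24) := pow_le_pow_right₀ one_le_two (by omega)
    _ = (2 ^ (n - 4 * r)) ^ 24 := pow_mul _ _ _
    _ ≤ (A.card : ℝ) ^ 24 := by gcongr
    _ = ((A.card : ℝ) ^ 2) ^ 12 := by rw [← pow_mul]
  have hupper : ((A.card : ℝ) ^ 2) ^ 12 ≤ (2 ^ 8 * (9 / 4) ^ 12 : ℝ) ^ n := calc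
    ((A.card : ℝ) ^ 2) ^ 12 ≤ (2 ^ (2 * n / 3) * (9 / 4) ^ n) ^ 12 := by gcongr
    _ = 2 ^ (2 * n / 3 * 12) * ((9 / 4) ^ 12) ^ n := by
      rw [mul_pow, ← pow_mul, pow_right_comm]
    _ ≤ 2 ^ (8 * n) * ((9 / 4) ^ 12) ^ n := by
      have : (2 : ℝ) ^ (2 * n / 3 * 12) ≤ 2 ^ (8 * n) :=
        pow_le_pow_right₀ one_le_two (by omega)
      gcongr
    _ = (2 ^ 8 * (9 / 4) ^ 12 : ℝ) ^ n := by rw [mul_pow, pow_mul]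
  have hstrict : (2 ^ 8 * (9 / 4) ^ 12 : ℝ) ^ n < (2 ^ 23 : ℝ) ^ n :=
    pow_lt_pow_left₀ (by norm_num) (by positivity) hn.ne'
  exact (hlower.trans hupper).not_gt hstrict

theorem exists_heavy_direction_with_solution (n r : ℕ)
    (hr : 1 ≤ r) (hrn : (r : ℝ) ≤ (n : ℝ) / 100)
    (u : Fin n → ZMod 2) (U₀ : Submodule (ZMod 2) (Fin n → ZMod 2))
    (hdim : n - 3 * r ≤ Module.finrank (ZMod 2) U₀)
    (q : Fin r → MvPolynomial (Fin n) (ZMod 2))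
    (hq : ∀ j, (q j).totalDegree ≤ 2) :
    ∃ v ∈ U₀, (2 * (n : ℝ)) / 3 ≤ (hammingNorm v : ℝ) ∧
      ∃ x : Fin n → ZMod 2, x - u ∈ U₀ ∧
        ∀ j : Fin r, MvPolynomial.eval x (q j) = MvPolynomial.eval (x + v) (q j) := by
  classical
  have hrn' : 100 * r ≤ n := by
    have : (100 * r : ℝ) ≤ n := by linarith
    exact_mod_cast this
  let T : Finset (Fin n → ZMod 2) := {w | w ∈ U₀}
  let F : (Fin n → ZMod 2) → Fin r → ZMod 2 := fun w j => MvPolynomial.eval (u + w) (q j)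
  have hT : T.card = 2 ^ Module.finrank (ZMod 2) U₀ := by
    have := Module.card_eq_pow_finrank (K := ZMod 2) (V := U₀)
    rw [ZMod.card] at this
    rw [← this]
    exact (Fintype.card_subtype _).symm
  obtain ⟨y, -, hy⟩ := Finset.exists_le_card_fiber_of_mul_le_card_of_maps_to
    (s := T) (t := Finset.univ) (f := F) (n := 2 ^ (n - 4 * r)) (fun _ _ => Finset.mem_univ _)
    Finset.univ_nonempty (by
      rw [hT, Finset.card_univ, Fintype.card_fun, ZMod.card, Fintype.card_fin, ← pow_add]
      exact Nat.pow_le_pow_right two_pos (by omega))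
  obtain ⟨a, ha, b, hb, hab⟩ :=
    exists_two_mul_le_three_mul_hammingDist (by omega) hrn' hy
  simp only [T, Finset.mem_filter, Finset.mem_univ, true_and] at ha hb
  refine ⟨-a + b, U₀.add_mem (U₀.neg_mem ha.1) hb.1, ?_, u + a, by simpa using ha.1, fun j => ?_⟩
  · rw [← hammingDist_eq_hammingNorm]
    have : (2 * n : ℝ) ≤ 3 * hammingDist a b := by exact_mod_cast hab
    linarith
  · rw [add_assoc, add_neg_cancel_left]
    exact congrFun (ha.2.trans hb.2.symm) j
end

section
/- Let U ⊆ 𝔽₂ⁿ be an affine subspace with dim(U) = n − k > 0. Then there exists u ∈ U with Hamming weight |u| ≤ k. -/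
open scoped BigOperators

noncomputable section

/-- Every coset of a subspace of `ι → K` contains a vector whose Hamming norm is at most the
codimension of the subspace. -/
theorem Submodule.exists_sub_mem_hammingNorm_le_finrank_quotient {K ι : Type*} [Field K]
    [DecidableEq K] [Fintype ι] (U : Submodule K (ι → K)) (u : ι → K) :
    ∃ x : ι → K, x - u ∈ U ∧ hammingNorm x ≤ Module.finrank K ((ι → K) ⧸ U) := by
  classical
  have hspan : Submodule.span K (Set.range (U.mkQ ∘ Pi.basisFun K ι)) = ⊤ := by
    rw [Set.range_comp, Submodule.span_image, (Pi.basisFun K ι).span_eq, Submodule.map_top,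
      Submodule.range_mkQ]
  obtain ⟨f, hf, hfspan, -⟩ :=
    Submodule.exists_fun_fin_finrank_span_eq K (Set.range (U.mkQ ∘ Pi.basisFun K ι))
  choose g hg using hf
  have hu : U.mkQ u ∈ Submodule.span K (Set.range f) := by
    rw [hfspan, hspan]
    exact Submodule.mem_top
  obtain ⟨c, hc⟩ := (Submodule.mem_span_range_iff_exists_fun K).1 hu
  refine ⟨∑ i, c i • Pi.basisFun K ι (g i), ?_, ?_⟩
  · rw [← Submodule.Quotient.eq, ← Submodule.mkQ_apply, ← Submodule.mkQ_apply, ← hc, map_sum]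
    simp only [map_smul, ← hg, Function.comp_apply]
  · calc
      _ ≤ (Finset.univ.image g).card := by
        refine Finset.card_le_card fun j hj => ?_
        by_contra hjg
        refine (Finset.mem_filter.1 hj).2 ?_
        rw [Finset.sum_apply]
        refine Finset.sum_eq_zero fun i _ => ?_
        have hne : j ≠ g i := fun h =>
          hjg (h ▸ Finset.mem_image_of_mem g (Finset.mem_univ i))
        simp [hne]
      _ ≤ _ := Finset.card_image_le
      _ = _ := by rw [Finset.card_univ, Fintype.card_fin, hspan, finrank_top]

theorem exists_low_weight_element (n k : ℕ) (hk : k < n)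
    (u : Fin n → ZMod 2) (U₀ : Submodule (ZMod 2) (Fin n → ZMod 2))
    (hdim : Module.finrank (ZMod 2) U₀ = n - k) :
    ∃ x : Fin n → ZMod 2, x - u ∈ U₀ ∧ hammingNorm x ≤ k := by
  obtain ⟨x, hx, hle⟩ := U₀.exists_sub_mem_hammingNorm_le_finrank_quotient u
  have hsum := U₀.finrank_quotient_add_finrank
  rw [Module.finrank_fin_fun] at hsum
  exact ⟨x, hx, hle.trans (by omega)⟩
end
end

section
/- Let 0 < p < 1/2 be a constant. There exists N (depending only on p) such that for all n ≥ N the following holds. Let f : 𝔽₂ⁿ → {0,1} be a function that (0.01, 0.01)-approximates THR_{pn}, and set m = 2·⌊pn⌋. For D ⊆ [n] of size m, let g_D : 𝔽₂^m → {0,1} be the function obtained from f by fixing all input bits outside of D to 0 (via a bijection between D and [m]). Then there exists D₀ ⊆ [n] of size m such that g := g_{D₀} satisfies Pr_{x uniform in 𝔽₂^m}[g(x) = Maj_m(x)] ≥ 3/4. -/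
open scoped BigOperators Classical

noncomputable section

/-- The majority function on `m` bits: `1` iff the Hamming weight is at least `m/2`. -/
def Maj (m : ℕ) (x : Fin m → ZMod 2) : Bool := decide (m ≤ 2 * hammingNorm x)

/-- The threshold function: `1` iff the Hamming weight is at least `kthr`. -/
def THR (n kthr : ℕ) (x : Fin n → ZMod 2) : Bool := decide (kthr ≤ hammingNorm x)

/-- The `k`-th layer of the Hamming cube `𝔽₂ⁿ`. -/
def layer (n k : ℕ) : Finset (Fin n → ZMod 2) :=
  Finset.univ.filter fun x => hammingNorm x = k

/-- `f` is `ε`-wrong on the layer `L_k` with respect to `THR n kthr`: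
it disagrees with the threshold function on at least an `ε` fraction of `L_k`. -/
def EpsWrong (n kthr k : ℕ) (f : (Fin n → ZMod 2) → Bool) (ε : ℝ) : Prop :=
  ε * (n.choose k : ℝ) ≤ (((layer n k).filter fun x => f x ≠ THR n kthr x).card : ℝ)

/-- `f` `(ε,γ)`-approximates `THR_{pn}`: it is `ε`-wrong on at most a `γ` fraction of the
layers `L_k` for `k ∈ [⌊pn⌋ - ⌈5√(2pn)⌉, ⌊pn⌋ + ⌈5√(2pn)⌉]`. -/
def ApproxTHR (n : ℕ) (p : ℝ) (f : (Fin n → ZMod 2) → Bool) (ε γ : ℝ) : Prop :=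
  (((Finset.Icc (⌊p * (n : ℝ)⌋₊ - ⌈5 * Real.sqrt (2 * p * n)⌉₊)
        (⌊p * (n : ℝ)⌋₊ + ⌈5 * Real.sqrt (2 * p * n)⌉₊)).filter
      fun k => EpsWrong n ⌊p * (n : ℝ)⌋₊ k f ε).card : ℝ) ≤
    γ * ((Finset.Icc (⌊p * (n : ℝ)⌋₊ - ⌈5 * Real.sqrt (2 * p * n)⌉₊)
        (⌊p * (n : ℝ)⌋₊ + ⌈5 * Real.sqrt (2 * p * n)⌉₊)).card : ℝ)

open Finset

theorem mem_layer {n k : ℕ} {x : Fin n → ZMod 2} : x ∈ layer n k ↔ hammingNorm x = k := by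
  simp [layer]

theorem ZMod.eq_one_of_ne_zero_two {a : ZMod 2} (h : a ≠ 0) : a = 1 := by
  revert a; decide

theorem card_layer (n k : ℕ) : (layer n k).card = n.choose k := by
  rw [← Fintype.card_fin n, ← Finset.card_univ, ← Finset.card_powersetCard, Finset.card_univ,
    Fintype.card_fin]
  refine Finset.card_bij' (fun x _ => univ.filter fun i => x i ≠ 0)
    (fun s _ i => if i ∈ s then 1 else 0) ?_ ?_ ?_ ?_
  · intro x hx
    rw [mem_layer] at hx
    rw [mem_powersetCard]
    exact ⟨subset_univ _, hx⟩
  · intro s hs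
    rw [mem_layer]
    rw [mem_powersetCard] at hs
    simpa [hammingNorm] using hs.2
  · intro x _
    funext i
    by_cases h : x i = 0
    · simp [h]
    · simp [ZMod.eq_one_of_ne_zero_two h]
  · intro s _
    ext i
    simp

theorem hammingNorm_comp_perm {n : ℕ} (y : Fin n → ZMod 2) (σ : Equiv.Perm (Fin n)) :
    hammingNorm (y ∘ σ) = hammingNorm y := by
  unfold hammingNorm
  exact Finset.card_bij (fun i _ => σ i) (by simp) (by simp)
    (fun j hj => ⟨σ.symm j, by simpa using hj, by simp⟩)

theorem exists_perm_of_hammingNorm_eq {n : ℕ} {y z : Fin n → ZMod 2}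
    (h : hammingNorm z = hammingNorm y) : ∃ τ : Equiv.Perm (Fin n), z = y ∘ τ := by
  have hc : Fintype.card {i // z i ≠ 0} = Fintype.card {i // y i ≠ 0} := by
    rw [Fintype.card_subtype, Fintype.card_subtype]
    exact h
  refine ⟨(Fintype.equivOfCardEq hc).extendSubtype, funext fun i => ?_⟩
  by_cases hi : z i = 0
  · have := (Fintype.equivOfCardEq hc).extendSubtype_not_mem i (by simpa using hi)
    simp only [not_not] at this
    simp [hi, this]
  · have := (Fintype.equivOfCardEq hc).extendSubtype_mem i hi
    simp only [Function.comp_apply]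
    rw [ZMod.eq_one_of_ne_zero_two hi, ZMod.eq_one_of_ne_zero_two this]

/-- A uniformly random permutation sends a point of a layer to a uniformly random point of it. -/
theorem card_perm_mul_choose {n k : ℕ} {y : Fin n → ZMod 2} (hy : y ∈ layer n k)
    (P : (Fin n → ZMod 2) → Prop) [DecidablePred P] :
    (univ.filter fun σ : Equiv.Perm (Fin n) => P (y ∘ σ)).card * n.choose k =
      n.factorial * ((layer n k).filter P).card := by
  have hconst : ∀ z ∈ layer n k,
      (univ.filter fun σ : Equiv.Perm (Fin n) => P (z ∘ σ)).card =
        (univ.filter fun σ : Equiv.Perm (Fin n) => P (y ∘ σ)).card := by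
    intro z hz
    rw [mem_layer] at hy hz
    obtain ⟨τ, rfl⟩ := exists_perm_of_hammingNorm_eq (hz.trans hy.symm)
    exact Finset.card_bij' (fun σ _ => τ * σ) (fun σ _ => τ⁻¹ * σ)
      (fun σ hσ => by simpa [Function.comp_assoc] using hσ)
      (fun σ hσ => by
        simp only [mem_filter, mem_univ, true_and] at hσ ⊢
        rwa [Function.comp_assoc, ← Equiv.Perm.coe_mul, mul_inv_cancel_left])
      (by simp) (by simp)
  have hlayer : ∀ σ : Equiv.Perm (Fin n),
      ((layer n k).filter fun z => P (z ∘ σ)).card = ((layer n k).filter P).card := by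
    intro σ
    refine Finset.card_bij' (fun z _ => z ∘ σ) (fun z _ => z ∘ σ.symm) ?_ ?_ ?_ ?_
    · intro z hz
      simpa [mem_layer, hammingNorm_comp_perm] using hz
    · intro z hz
      simpa [mem_layer, hammingNorm_comp_perm, Function.comp_assoc] using hz
    · intro z _
      simp [Function.comp_assoc]
    · intro z _
      simp [Function.comp_assoc]
  have hdouble := Finset.sum_card_bipartiteAbove_eq_sum_card_bipartiteBelow
    (s := layer n k) (t := (univ : Finset (Equiv.Perm (Fin n)))) (fun z (σ : Equiv.Perm (Fin n)) => P (z ∘ σ))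
  simp only [Finset.bipartiteAbove, Finset.bipartiteBelow] at hdouble
  rw [Finset.sum_congr rfl hconst, Finset.sum_congr rfl fun σ _ => hlayer σ] at hdouble
  simpa [card_layer, Fintype.card_perm, mul_comm] using hdouble

theorem extend_trans_perm {m n : ℕ} (e : Fin m ↪ Fin n) (σ : Equiv.Perm (Fin n))
    (x : Fin m → ZMod 2) :
    Function.extend (e.trans σ.symm.toEmbedding) x 0 = Function.extend e x 0 ∘ σ := by
  funext i
  by_cases h : ∃ j, e j = σ i
  · obtain ⟨j, hj⟩ := h
    have hi : i = (e.trans σ.symm.toEmbedding) j := by simp [hj]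
    rw [Function.comp_apply, ← hj, e.injective.extend_apply, hi,
      (e.trans σ.symm.toEmbedding).injective.extend_apply]
  · rw [Function.comp_apply, Function.extend_apply' _ _ _ h, Function.extend_apply']
    · rfl
    · rintro ⟨j, rfl⟩
      exact h ⟨j, by simp⟩

theorem hammingNorm_extend {m n : ℕ} (e : Fin m ↪ Fin n) (x : Fin m → ZMod 2) :
    hammingNorm (Function.extend e x 0) = hammingNorm x := by
  symm
  unfold hammingNorm
  refine Finset.card_bij (fun i _ => e i) ?_ (fun a _ b _ h => e.injective h) ?_
  · intro i hi
    simpa [e.injective.extend_apply] using hi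
  · intro i hi
    by_cases h : ∃ j, e j = i
    · obtain ⟨j, rfl⟩ := h
      exact ⟨j, by simpa [e.injective.extend_apply] using hi, rfl⟩
    · simp [Function.extend_apply' _ _ _ h] at hi

theorem centralBinom_sq_mul_le (K : ℕ) : K.centralBinom ^ 2 * (2 * K + 1) ≤ 16 ^ K := by
  induction K with
  | zero => simp
  | succ K ih =>
    have h := Nat.succ_mul_centralBinom_succ K
    refine Nat.le_of_mul_le_mul_left (c := (K + 1) ^ 2) ?_ (by positivity)
    calc (K + 1) ^ 2 * ((K + 1).centralBinom ^ 2 * (2 * (K + 1) + 1))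
        = ((K + 1) * (K + 1).centralBinom) ^ 2 * (2 * K + 3) := by ring
      _ = (K.centralBinom ^ 2 * (2 * K + 1)) * (4 * ((2 * K + 1) * (2 * K + 3))) := by
        rw [h]; ring
      _ ≤ 16 ^ K * (4 * (4 * (K + 1) ^ 2)) := Nat.mul_le_mul ih (by nlinarith)
      _ = (K + 1) ^ 2 * 16 ^ (K + 1) := by ring

theorem choose_two_mul_mul_sqrt_le (K k : ℕ) :
    ((2 * K).choose k : ℝ) * √(2 * K + 1) ≤ 2 ^ (2 * K) := by
  have h1 : ((2 * K).choose k : ℝ) ≤ K.centralBinom := by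
    exact_mod_cast Nat.choose_le_centralBinom k K
  have h2 : (K.centralBinom : ℝ) ^ 2 * (2 * K + 1) ≤ 16 ^ K := by
    exact_mod_cast centralBinom_sq_mul_le K
  refine (mul_le_mul_of_nonneg_right h1 (Real.sqrt_nonneg _)).trans ?_
  refine abs_le_of_sq_le_sq' ?_ (by positivity) |>.2
  rw [mul_pow, Real.sq_sqrt (by positivity), ← pow_mul, mul_right_comm, pow_mul]
  norm_num
  exact h2

theorem sum_comp_hammingNorm (m : ℕ) (F : ℕ → ℝ) :
    ∑ x : Fin m → ZMod 2, F (hammingNorm x) = ∑ k ∈ range (m + 1), (m.choose k : ℝ) * F k := by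
  rw [← Finset.sum_fiberwise_of_maps_to (t := range (m + 1)) (g := hammingNorm)]
  · refine Finset.sum_congr rfl fun k _ => ?_
    rw [← card_layer, ← nsmul_eq_mul, ← Finset.sum_const]
    exact Finset.sum_congr rfl fun x hx => by rw [mem_layer.1 hx]
  · intro x _
    have := hammingNorm_le_card_fintype (x := x)
    simp only [Fintype.card_fin] at this
    simpa [Nat.lt_succ_iff] using this

theorem sum_sq_hammingNorm_sub (m : ℕ) :
    ∑ x : Fin m → ZMod 2, ((m : ℝ) / 2 - hammingNorm x) ^ 2 = (m : ℝ) / 4 * 2 ^ m := by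
  have h := congrArg (Polynomial.eval (1 / 2 : ℝ)) (bernsteinPolynomial.variance ℝ m)
  simp only [Polynomial.eval_finsetSum, Polynomial.eval_mul, Polynomial.eval_pow,
    Polynomial.eval_sub, Polynomial.eval_X, Polynomial.eval_natCast,
    Polynomial.eval_one, bernsteinPolynomial, nsmul_eq_mul] at h
  rw [sum_comp_hammingNorm m fun k => ((m : ℝ) / 2 - k) ^ 2]
  have h2 : (m : ℝ) / 4 * 2 ^ m = m * (1 / 2) * (1 - 1 / 2) * 2 ^ m := by ring
  rw [h2, ← h, Finset.sum_mul]
  refine Finset.sum_congr rfl fun k hk => ?_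
  have hk : k ≤ m := by simpa [Nat.lt_succ_iff] using hk
  have h3 : (1 / 2 : ℝ) ^ k * (1 - 1 / 2) ^ (m - k) * 2 ^ m = 1 := by
    rw [show (1 : ℝ) - 1 / 2 = 1 / 2 by norm_num, ← pow_add, Nat.add_sub_cancel' hk, ← mul_pow]
    norm_num
  linear_combination (-(m.choose k : ℝ) * ((m : ℝ) / 2 - k) ^ 2) * h3

theorem card_filter_far_le (m : ℕ) (hm : 0 < m) :
    ((univ.filter fun x : Fin m → ZMod 2 =>
      25 * (m : ℝ) ≤ ((m : ℝ) / 2 - hammingNorm x) ^ 2).card : ℝ) ≤ 0.01 * 2 ^ m := by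
  have hm' : (0 : ℝ) < m := by exact_mod_cast hm
  set S := univ.filter fun x : Fin m → ZMod 2 =>
      25 * (m : ℝ) ≤ ((m : ℝ) / 2 - hammingNorm x) ^ 2
  have h : (S.card : ℝ) * (25 * m) ≤ m / 4 * 2 ^ m := by
    rw [← sum_sq_hammingNorm_sub, ← nsmul_eq_mul]
    refine (Finset.card_nsmul_le_sum S _ _ fun x hx => (mem_filter.1 hx).2).trans ?_
    exact Finset.sum_le_sum_of_subset_of_nonneg (subset_univ _) fun _ _ _ => sq_nonneg _
  refine le_of_mul_le_mul_right ?_ (show (0 : ℝ) < 25 * m by positivity)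
  linarith

/-- Averaging over random embeddings: the wrong inputs number at most the layerwise error. -/
theorem exists_embedding_card_wrong_le {m n : ℕ} (hmn : m ≤ n)
    (P : (Fin n → ZMod 2) → Prop) [DecidablePred P]
    (F : ℕ → ℝ)
    (hF : ∀ k ≤ m, (((layer n k).filter P).card : ℝ) ≤ F k * n.choose k) :
    ∃ e : Fin m ↪ Fin n,
      ((univ.filter fun x : Fin m → ZMod 2 => P (Function.extend e x 0)).card : ℝ) ≤
        ∑ x : Fin m → ZMod 2, F (hammingNorm x) := by
  let e₀ : Fin m ↪ Fin n := Fin.castLEEmb hmn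
  by_contra! hcon
  have hx : ∀ x : Fin m → ZMod 2,
      ((univ.filter fun σ : Equiv.Perm (Fin n) =>
        P (Function.extend e₀ x 0 ∘ σ)).card : ℝ) ≤ n.factorial * F (hammingNorm x) := by
    intro x
    have hk : hammingNorm x ≤ m := by
      simpa using hammingNorm_le_card_fintype (x := x)
    have hc : (0 : ℝ) < n.choose (hammingNorm x) := by
      exact_mod_cast Nat.choose_pos (hk.trans hmn)
    have h1 : ((univ.filter fun σ : Equiv.Perm (Fin n) =>
        P (Function.extend e₀ x 0 ∘ σ)).card : ℝ) * n.choose (hammingNorm x) =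
        n.factorial * ((layer n (hammingNorm x)).filter P).card := by
      exact_mod_cast card_perm_mul_choose (mem_layer.2 (hammingNorm_extend e₀ x)) P
    refine le_of_mul_le_mul_right ?_ hc
    rw [h1, mul_assoc]
    exact mul_le_mul_of_nonneg_left (hF _ hk) (by positivity)
  have hdouble := Finset.sum_card_bipartiteAbove_eq_sum_card_bipartiteBelow
    (s := (univ : Finset (Fin m → ZMod 2))) (t := (univ : Finset (Equiv.Perm (Fin n))))
    (fun x (σ : Equiv.Perm (Fin n)) => P (Function.extend e₀ x 0 ∘ σ))
  simp only [Finset.bipartiteAbove, Finset.bipartiteBelow] at hdouble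
  have hlt : ∑ _σ : Equiv.Perm (Fin n), ∑ x : Fin m → ZMod 2, F (hammingNorm x) <
      ∑ σ : Equiv.Perm (Fin n),
        ((univ.filter fun x : Fin m → ZMod 2 => P (Function.extend e₀ x 0 ∘ σ)).card : ℝ) := by
    refine Finset.sum_lt_sum_of_nonempty univ_nonempty fun σ _ => ?_
    simpa only [extend_trans_perm] using hcon (e₀.trans σ.symm.toEmbedding)
  have hle := Finset.sum_le_sum fun x (_ : x ∈ univ) => hx x
  rw [← Nat.cast_sum, ← hdouble, Nat.cast_sum] at hlt
  rw [← Finset.mul_sum] at hle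
  simp only [sum_const, card_univ, Fintype.card_perm, Fintype.card_fin, nsmul_eq_mul] at hlt
  exact absurd hle (not_le.2 hlt)

theorem card_filter_hammingNorm_mem_le (K : ℕ) (B : Finset ℕ) :
    ((univ.filter fun x : Fin (2 * K) → ZMod 2 => hammingNorm x ∈ B).card : ℝ) *
      √(2 * K + 1) ≤ B.card * 2 ^ (2 * K) := by
  have h : (univ.filter fun x : Fin (2 * K) → ZMod 2 => hammingNorm x ∈ B).card ≤
      ∑ k ∈ B, (2 * K).choose k := by
    simp only [← card_layer]
    refine le_trans (card_le_card fun x hx => ?_) Finset.card_biUnion_le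
    simpa [mem_layer] using hx
  have h' : ((univ.filter fun x : Fin (2 * K) → ZMod 2 => hammingNorm x ∈ B).card : ℝ) ≤
      ∑ k ∈ B, ((2 * K).choose k : ℝ) := by exact_mod_cast h
  refine (mul_le_mul_of_nonneg_right h' (Real.sqrt_nonneg _)).trans ?_
  rw [Finset.sum_mul, ← nsmul_eq_mul]
  exact Finset.sum_le_card_nsmul _ _ _ fun k _ => choose_two_mul_mul_sqrt_le K k

theorem restriction_approximates_majority (p : ℝ) (hp0 : 0 < p) (hp1 : p < 1 / 2) :
    ∃ N : ℕ, ∀ n : ℕ, N ≤ n → ∀ f : (Fin n → ZMod 2) → Bool,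
      ApproxTHR n p f 0.01 0.01 →
      ∃ e : Fin (2 * ⌊p * (n : ℝ)⌋₊) ↪ Fin n,
        (3 / 4 : ℝ) * 2 ^ (2 * ⌊p * (n : ℝ)⌋₊) ≤
          ((Finset.univ.filter fun x : Fin (2 * ⌊p * (n : ℝ)⌋₊) → ZMod 2 =>
              f (Function.extend e x 0) = Maj (2 * ⌊p * (n : ℝ)⌋₊) x).card : ℝ) := by
  refine ⟨⌈1 / p⌉₊, fun n hn f hf => ?_⟩
  have hpn : 1 ≤ p * n := by
    have := (Nat.le_ceil (1 / p)).trans (Nat.cast_le.2 hn)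
    rwa [div_le_iff₀' hp0] at this
  have hK : 0 < ⌊p * (n : ℝ)⌋₊ := Nat.floor_pos.2 hpn
  have hKle := Nat.floor_le (show 0 ≤ p * (n : ℝ) by linarith)
  have hKlt := Nat.lt_floor_add_one (p * (n : ℝ))
  unfold ApproxTHR at hf
  generalize ⌊p * (n : ℝ)⌋₊ = K at *
  have hwge := Nat.le_ceil (5 * √(2 * p * n))
  have hwlt := Nat.ceil_lt_add_one (show 0 ≤ 5 * √(2 * p * n) by positivity)
  generalize ⌈5 * √(2 * p * n)⌉₊ = w at *
  set I := Finset.Icc (K - w) (K + w) with hI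
  set B := I.filter fun k => EpsWrong n K k f 0.01 with hB
  have hK' : (1 : ℝ) ≤ K := by exact_mod_cast hK
  have hmn : 2 * K ≤ n := by
    have : (2 * K : ℝ) ≤ n := by nlinarith [Nat.cast_nonneg (α := ℝ) n]
    exact_mod_cast this
  have hIcard : (I.card : ℝ) ≤ 2 * w + 1 := by
    have : I.card ≤ 2 * w + 1 := by rw [hI, Nat.card_Icc]; omega
    exact_mod_cast this
  have hw_sq : 50 * (K : ℝ) ≤ (w : ℝ) ^ 2 := by
    have h1 := Real.sq_sqrt (show 0 ≤ 2 * p * (n : ℝ) by linarith)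
    have h2 := pow_le_pow_left₀ (by positivity) hwge 2
    nlinarith
  have hfar : ∀ k, k ∉ I → 25 * ((2 * K : ℕ) : ℝ) ≤ (((2 * K : ℕ) : ℝ) / 2 - k) ^ 2 := by
    intro k hk
    push_cast
    have hw0 := Nat.cast_nonneg (α := ℝ) w
    rw [hI, Finset.mem_Icc, not_and_or, not_le, not_le] at hk
    rcases hk with hk | hk
    · have : (k + w : ℝ) ≤ K := by exact_mod_cast (show k + w ≤ K by omega)
      nlinarith
    · have : (K + w : ℝ) ≤ k := by exact_mod_cast (show K + w ≤ k by omega)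
      nlinarith
  obtain ⟨e, he⟩ := exists_embedding_card_wrong_le hmn (fun y => f y ≠ THR n K y)
    (fun k => (if k ∉ I then 1 else 0) + 0.01 + (if k ∈ B then 1 else 0)) (by
      intro k _
      have hle : (((layer n k).filter fun y => f y ≠ THR n K y).card : ℝ) ≤ n.choose k := by
        rw [← card_layer]
        exact_mod_cast card_filter_le _ _
      have hc := Nat.cast_nonneg (α := ℝ) (n.choose k)
      by_cases hkI : k ∈ I
      · by_cases hkB : k ∈ B
        · simp only [hkI, hkB, not_true_eq_false, if_true, if_false]
          linarith
        · have : ¬ EpsWrong n K k f 0.01 := fun h => hkB (mem_filter.2 ⟨hkI, h⟩)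
          unfold EpsWrong at this
          simp only [hkI, hkB, not_true_eq_false, if_false]
          linarith
      · simp only [hkI, not_false_eq_true, if_true]
        split_ifs <;> linarith)
  refine ⟨e, ?_⟩
  have hMaj : ∀ x : Fin (2 * K) → ZMod 2, THR n K (Function.extend e x 0) = Maj (2 * K) x := by
    intro x
    simp [THR, Maj, hammingNorm_extend]
  simp only [hMaj, sum_add_distrib, sum_boole, sum_const, nsmul_eq_mul, card_univ,
    Fintype.card_fun, ZMod.card, Fintype.card_fin] at he
  have hout : ((univ.filter fun x : Fin (2 * K) → ZMod 2 => hammingNorm x ∉ I).card : ℝ) ≤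
      0.01 * 2 ^ (2 * K) := by
    refine le_trans ?_ (card_filter_far_le (2 * K) (by omega))
    exact_mod_cast card_le_card (monotone_filter_right _ fun x _ hx => hfar _ hx)
  have hbad : ((univ.filter fun x : Fin (2 * K) → ZMod 2 => hammingNorm x ∈ B).card : ℝ) ≤
      0.2 * 2 ^ (2 * K) := by
    have hr1 : 1 ≤ √(2 * (K : ℝ) + 1) := Real.one_le_sqrt.2 (by linarith)
    have hs : √(2 * p * n) ≤ 1.5 * √(2 * (K : ℝ) + 1) := by
      rw [Real.sqrt_le_left (by positivity), mul_pow, Real.sq_sqrt (by positivity)]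
      linarith
    refine le_of_mul_le_mul_right ((card_filter_hammingNorm_mem_le K B).trans ?_)
      (show 0 < √(2 * (K : ℝ) + 1) by linarith)
    have hBr : (B.card : ℝ) ≤ 0.2 * √(2 * (K : ℝ) + 1) := by linarith
    calc (B.card : ℝ) * 2 ^ (2 * K) ≤ 0.2 * √(2 * (K : ℝ) + 1) * 2 ^ (2 * K) := by gcongr
      _ = _ := by ring
  have htotal := card_filter_add_card_filter_not (s := univ)
    (fun x : Fin (2 * K) → ZMod 2 => f (Function.extend e x 0) = Maj (2 * K) x)
  simp only [card_univ, Fintype.card_fun, ZMod.card, Fintype.card_fin] at htotal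
  have htotal' : ((univ.filter fun x : Fin (2 * K) → ZMod 2 =>
      f (Function.extend e x 0) = Maj (2 * K) x).card : ℝ) +
      (univ.filter fun x : Fin (2 * K) → ZMod 2 =>
        f (Function.extend e x 0) ≠ Maj (2 * K) x).card = 2 ^ (2 * K) := by
    exact_mod_cast htotal
  push_cast at he
  have hpow : (0 : ℝ) < 2 ^ (2 * K) := by positivity
  linarith
end
end

section
/- Let 0 < p < 1/2 and C ∈ ℝ. There exist a constant c > 0 and N ∈ ℕ (both depending only on p and C) such that for all n ≥ N, setting k = ⌊pn + C√n⌋ (which satisfies 0 ≤ k ≤ n for large n), the binomial probability W_k = C(n,k) · p^k · (1−p)^(n−k) satisfies W_k ≥ c/√n. -/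
open scoped BigOperators

noncomputable section

lemma factorial_le_exp_mul_sqrt_mul_pow {k n : ℕ} (hkn : k ≤ n) (hn : 1 ≤ n) :
    (k.factorial : ℝ) ≤ Real.exp 1 * Real.sqrt n * (k / Real.exp 1) ^ k := by
  rcases Nat.eq_zero_or_pos k with rfl | hk
  · have h1 : 1 ≤ Real.exp 1 := Real.one_le_exp zero_le_one
    have h2 : 1 ≤ Real.sqrt n := Real.one_le_sqrt.2 (by exact_mod_cast hn)
    simpa using one_le_mul_of_one_le_of_one_le h1 h2
  · have hanti : Stirling.stirlingSeq k ≤ Stirling.stirlingSeq 1 := by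
      obtain ⟨j, rfl⟩ := Nat.exists_eq_succ_of_ne_zero hk.ne'
      exact Stirling.stirlingSeq'_antitone (Nat.zero_le j)
    have hk' : (0 : ℝ) < k := by exact_mod_cast hk
    rw [Stirling.stirlingSeq_one, Stirling.stirlingSeq, div_le_iff₀ (by positivity)] at hanti
    calc (k.factorial : ℝ)
        ≤ Real.exp 1 / √2 * (√(2 * k) * (k / Real.exp 1) ^ k) := hanti
      _ = Real.exp 1 * √k * (k / Real.exp 1) ^ k := by
          rw [Real.sqrt_mul (by norm_num)]
          field_simp
      _ ≤ _ := by gcongr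

lemma natCast_pow_self_le_pow_mul_exp {x : ℝ} (hx : 0 < x) (k : ℕ) :
    (k : ℝ) ^ k ≤ x ^ k * Real.exp ((k : ℝ) ^ 2 / x - k) := by
  have h : (k : ℝ) / x ≤ Real.exp (k / x - 1) := by
    simpa using Real.add_one_le_exp ((k : ℝ) / x - 1)
  have hk : (k : ℝ) ≤ x * Real.exp (k / x - 1) := by
    rwa [div_le_iff₀' hx] at h
  calc (k : ℝ) ^ k ≤ (x * Real.exp (k / x - 1)) ^ k := by gcongr
    _ = _ := by
      rw [mul_pow, ← Real.exp_nat_mul]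
      congr 2
      ring

lemma factorial_le_pow_mul_exp {k n : ℕ} (hkn : k ≤ n) (hn : 1 ≤ n) {x : ℝ} (hx : 0 < x) :
    (k.factorial : ℝ) ≤
      Real.exp 1 * Real.sqrt n * (x ^ k * Real.exp ((k : ℝ) ^ 2 / x - 2 * k)) := by
  refine (factorial_le_exp_mul_sqrt_mul_pow hkn hn).trans ?_
  gcongr
  rw [div_pow, div_le_iff₀ (by positivity), ← Real.exp_nat_mul, mul_assoc, ← Real.exp_add]
  refine (natCast_pow_self_le_pow_mul_exp hx k).trans_eq ?_
  congr 2
  ring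

/-- A non-asymptotic Gaussian lower bound for the binomial probabilities. -/
lemma exp_neg_div_sqrt_le_binomial_mass {p : ℝ} (hp0 : 0 < p) (hp1 : p < 1) {k n : ℕ}
    (hkn : k ≤ n) (hn : 1 ≤ n) :
    Real.exp (-2 - ((k : ℝ) - n * p) ^ 2 / (n * p * (1 - p))) / Real.sqrt n ≤
      (n.choose k : ℝ) * p ^ k * (1 - p) ^ (n - k) := by
  obtain ⟨m, hm⟩ := Nat.exists_eq_add_of_le hkn
  have hq : 0 < 1 - p := by linarith
  have hn0 : (0 : ℝ) < n := by exact_mod_cast hn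
  have hk := factorial_le_pow_mul_exp hkn hn (mul_pos hn0 hp0)
  have hm' := factorial_le_pow_mul_exp (show m ≤ n by omega) hn (mul_pos hn0 hq)
  have hfac : √(n : ℝ) * (n / Real.exp 1) ^ n ≤ n.factorial := by
    refine le_trans ?_ (Stirling.le_factorial_stirling n)
    gcongr
    nlinarith [Real.pi_gt_three]
  have hexp : (k : ℝ) ^ 2 / (n * p) - 2 * k + ((m : ℝ) ^ 2 / (n * (1 - p)) - 2 * m) =
      (k - n * p) ^ 2 / (n * p * (1 - p)) - n := by
    have hmk : (m : ℝ) = n - k := by rw [hm]; push_cast; ring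
    rw [hmk]
    field_simp
    ring
  set d := ((k : ℝ) - n * p) ^ 2 / (n * p * (1 - p))
  have hprod : (k.factorial * m.factorial : ℝ) ≤
      Real.exp (2 + d - n) * n * n ^ n * (p ^ k * (1 - p) ^ m) := by
    calc (k.factorial * m.factorial : ℝ) ≤ _ := mul_le_mul hk hm' (by positivity) (by positivity)
      _ = (Real.exp 1 * Real.exp 1 * (Real.exp ((k : ℝ) ^ 2 / (n * p) - 2 * k) *
            Real.exp ((m : ℝ) ^ 2 / (n * (1 - p)) - 2 * m))) * (√(n : ℝ) * √(n : ℝ)) *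
            ((n : ℝ) ^ k * (n : ℝ) ^ m) * (p ^ k * (1 - p) ^ m) := by
          rw [mul_pow, mul_pow]
          ring
      _ = _ := by
          rw [← Real.exp_add, ← Real.exp_add, ← Real.exp_add, hexp, Real.mul_self_sqrt hn0.le,
            ← pow_add, ← hm]
          congr 4
          ring
  rw [Nat.cast_choose ℝ hkn, show n - k = m by omega, mul_assoc, div_mul_eq_mul_div,
    div_le_div_iff₀ (by positivity) (by positivity)]
  calc Real.exp (-2 - d) * (k.factorial * m.factorial : ℝ)
      ≤ Real.exp (-2 - d) * (Real.exp (2 + d - n) * n * n ^ n * (p ^ k * (1 - p) ^ m)) := by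
        gcongr
    _ = Real.exp (-2 - d) * Real.exp (2 + d - n) * (√(n : ℝ) * √(n : ℝ)) * n ^ n *
          (p ^ k * (1 - p) ^ m) := by
        rw [Real.mul_self_sqrt hn0.le]
        ring
    _ = √(n : ℝ) * (n / Real.exp 1) ^ n * (p ^ k * (1 - p) ^ m) * √(n : ℝ) := by
        rw [← Real.exp_add, show -2 - d + (2 + d - n) = -(n * 1 : ℝ) by ring, Real.exp_neg,
          Real.exp_nat_mul, div_pow]
        ring
    _ ≤ _ := by gcongr

theorem central_binomial_mass_lower_bound (p C : ℝ) (hp0 : 0 < p) (hp1 : p < 1 / 2) :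
    ∃ c > (0 : ℝ), ∃ N : ℕ, ∀ n : ℕ, N ≤ n →
      ⌊p * (n : ℝ) + C * Real.sqrt n⌋₊ ≤ n ∧
      c / Real.sqrt n ≤
        (n.choose ⌊p * (n : ℝ) + C * Real.sqrt n⌋₊ : ℝ) *
          p ^ ⌊p * (n : ℝ) + C * Real.sqrt n⌋₊ *
          (1 - p) ^ (n - ⌊p * (n : ℝ) + C * Real.sqrt n⌋₊) := by
  have hq : 0 < 1 - p := by linarith
  refine ⟨Real.exp (-2 - (|C| + 1) ^ 2 / (p * (1 - p))), Real.exp_pos _,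
    max 1 ⌈(|C| / p) ^ 2⌉₊, fun n hN => ?_⟩
  have hn : 1 ≤ n := (le_max_left _ _).trans hN
  have hn1 : (1 : ℝ) ≤ n := by exact_mod_cast hn
  have hn0 : (0 : ℝ) < n := by linarith
  have hs1 : 1 ≤ √(n : ℝ) := Real.one_le_sqrt.2 hn1
  have hss : √(n : ℝ) * √(n : ℝ) = n := Real.mul_self_sqrt hn0.le
  have hCs : |C| ≤ p * √(n : ℝ) := by
    rw [← div_le_iff₀' hp0]
    exact Real.le_sqrt_of_sq_le (Nat.ceil_le.1 ((le_max_right _ _).trans hN))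
  have hCn : |C * √(n : ℝ)| ≤ p * n := by
    rw [abs_mul, abs_of_nonneg (Real.sqrt_nonneg _)]
    nlinarith
  have hx0 : 0 ≤ p * (n : ℝ) + C * √(n : ℝ) := by linarith [neg_abs_le (C * √(n : ℝ))]
  have hkn : ⌊p * (n : ℝ) + C * √(n : ℝ)⌋₊ ≤ n :=
    Nat.floor_le_of_le (by nlinarith [le_abs_self (C * √(n : ℝ))])
  refine ⟨hkn, le_trans ?_ (exp_neg_div_sqrt_le_binomial_mass hp0 (by linarith) hkn hn)⟩
  have hle := Nat.floor_le hx0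
  have hlt := Nat.lt_floor_add_one (p * (n : ℝ) + C * √(n : ℝ))
  have hdev : |(⌊p * (n : ℝ) + C * √(n : ℝ)⌋₊ : ℝ) - n * p| ≤ (|C| + 1) * √(n : ℝ) := by
    rw [abs_le]
    constructor <;> nlinarith [le_abs_self C, neg_abs_le C]
  have hsq := sq_le_sq' (abs_le.1 hdev).1 (abs_le.1 hdev).2
  rw [mul_pow, Real.sq_sqrt hn0.le] at hsq
  have hle_div : ((⌊p * (n : ℝ) + C * √(n : ℝ)⌋₊ : ℝ) - n * p) ^ 2 / (n * p * (1 - p)) ≤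
      (|C| + 1) ^ 2 / (p * (1 - p)) := by
    rw [div_le_div_iff₀ (by positivity) (by positivity)]
    calc _ ≤ (|C| + 1) ^ 2 * n * (p * (1 - p)) := by gcongr
      _ = _ := by ring
  gcongr
end
end
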